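/- arXiv:1710.04769 — 11 statements merged into one kernel-verified Lean document; each statement's English description precedes it below -/
import Mathlib

section
/- Let L be a positive definite integral lattice of rank d > 1 and let α ∈ L be nonzero such that ⟨α, α⟩ divides 2⟨α, γ⟩ for every γ ∈ L (equivalently, 2α/⟨α,α⟩ lies in the dual lattice L°). Assume there do not exist a ℤ-submodule L₁ of L and γ ∈ L such that L is the internal direct sum of L₁ and ℤγ with ⟨L₁, γ⟩ = 0 and α ∈ ℤγ. Then α ∉ 2L, and moreover there exists β ∈ L such that the integer 2⟨α, β⟩/⟨α, α⟩ is odd. -/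
/-- If `B γ γ` is nonzero and divides `B x γ` for every `x`, then the module is the orthogonal
direct sum of the left orthogonal complement of `γ` and the span of `γ`. -/
theorem isCompl_ker_flip_span_singleton {R M : Type*} [CommRing R] [IsDomain R]
    [AddCommGroup M] [Module R M] (B : M →ₗ[R] M →ₗ[R] R) (γ : M) (hγ : B γ γ ≠ 0)
    (h : ∀ x, B γ γ ∣ B x γ) :
    IsCompl (LinearMap.ker (B.flip γ)) (Submodule.span R {γ}) := by
  refine ⟨Submodule.disjoint_def.2 fun x hx hxγ => ?_, codisjoint_iff.2 ?_⟩
  · obtain ⟨c, rfl⟩ := Submodule.mem_span_singleton.1 hxγ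
    have hc : c * B γ γ = 0 := by simpa only [LinearMap.mem_ker, LinearMap.flip_apply, map_smul,
      LinearMap.smul_apply, smul_eq_mul] using hx
    rw [(mul_eq_zero.1 hc).resolve_right hγ, zero_smul]
  · refine eq_top_iff.2 fun x _ => ?_
    obtain ⟨c, hc⟩ := h x
    refine Submodule.mem_sup.2 ⟨x - c • γ, ?_, c • γ, Submodule.mem_span_singleton.2 ⟨c, rfl⟩,
      sub_add_cancel _ _⟩
    rw [LinearMap.mem_ker, LinearMap.flip_apply, map_sub, map_smul, LinearMap.sub_apply,
      LinearMap.smul_apply, hc, smul_eq_mul, mul_comm, sub_self]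

/-- Let `L` be a positive definite integral lattice of rank `d > 1`,
`α ≠ 0` with `⟨α,α⟩ ∣ 2⟨α,γ⟩` for all `γ`.  If there is no orthogonal decomposition
`L = L₁ ⊕ ℤγ` with `α ∈ ℤγ`, then `α ∉ 2L` and there exists `β ∈ L` such that the
integer `2⟨α,β⟩/⟨α,α⟩` is odd. -/
theorem screener_not_in_two_L_and_odd_pairing
    (d : ℕ) (hd : 1 < d) (L : Type*) [AddCommGroup L] [Module ℤ L]
    [Module.Free ℤ L] [Module.Finite ℤ L] (hrank : Module.finrank ℤ L = d)
    (B : L →ₗ[ℤ] L →ₗ[ℤ] ℤ) (hsymm : ∀ x y : L, B x y = B y x)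
    (hpos : ∀ x : L, x ≠ 0 → 0 < B x x)
    (α : L) (hα : α ≠ 0) (hdvd : ∀ γ : L, B α α ∣ 2 * B α γ)
    (hnosplit : ¬ ∃ (L₁ : Submodule ℤ L) (γ : L),
        IsCompl L₁ (Submodule.span ℤ {γ}) ∧ (∀ x ∈ L₁, B x γ = 0) ∧
        α ∈ Submodule.span ℤ ({γ} : Set L)) :
    (¬ ∃ β : L, α = (2 : ℤ) • β) ∧
      ∃ (β : L) (k : ℤ), 2 * B α β = k * B α α ∧ Odd k := by
  have key : ∀ γ : L, γ ≠ 0 → α ∈ Submodule.span ℤ ({γ} : Set L) → ¬ ∀ x, B γ γ ∣ B γ x :=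
    fun γ hγ hαγ h => hnosplit ⟨LinearMap.ker (B.flip γ), γ,
      isCompl_ker_flip_span_singleton B γ (hpos γ hγ).ne' fun x => hsymm γ x ▸ h x,
      fun _ hx => hx, hαγ⟩
  constructor
  · rintro ⟨β, h2⟩
    obtain rfl : α = β + β := h2.trans (two_zsmul β)
    have hβ : β ≠ 0 := by
      rintro rfl
      exact hα (add_zero _)
    refine key β hβ (Submodule.mem_span_singleton.2 ⟨2, two_smul ℤ β⟩) fun x => ?_
    obtain ⟨c, hc⟩ := hdvd x
    simp only [map_add, LinearMap.add_apply] at hc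
    exact ⟨c, by linarith⟩
  · by_contra! hodd
    refine key α hα (Submodule.mem_span_singleton_self α) fun x => ?_
    obtain ⟨k, hk⟩ := hdvd x
    obtain ⟨c, rfl⟩ := Int.not_odd_iff_even.1 (hodd x k (by rw [hk, mul_comm]))
    exact ⟨c, by linarith⟩
end

section
/- Let L be a positive definite integral lattice and let α, β ∈ L be screeners with ⟨α, α⟩ ≤ ⟨β, β⟩. Then exactly one of the following holds: (i) ⟨α, β⟩ = 0; (ii) there is a sign ε ∈ {1, −1} with ⟨α, β⟩ = ε⟨β, β⟩ and α = εβ; (iii) 2⟨α, β⟩ = ±⟨β, β⟩ and ⟨β, β⟩ = a⟨α, α⟩ for some a ∈ {1, 2, 3}. -/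
/-- An element `β` of an integral lattice with bilinear form `B` is a *screener* if
`⟨β,β⟩` is even, `β ∉ 2L`, and `⟨β,β⟩ ∣ 2⟨β,γ⟩` for every `γ ∈ L`. -/
def IsScreener {L : Type*} [AddCommGroup L] [Module ℤ L]
    (B : L →ₗ[ℤ] L →ₗ[ℤ] ℤ) (β : L) : Prop :=
  Even (B β β) ∧ (¬ ∃ γ : L, β = (2 : ℤ) • γ) ∧ (∀ γ : L, B β β ∣ 2 * B β γ)

theorem bilin_add_smul_self {L : Type*} [AddCommGroup L] [Module ℤ L]
    (B : L →ₗ[ℤ] L →ₗ[ℤ] ℤ) (hsymm : ∀ x y : L, B x y = B y x) (x y : L) (c : ℤ) :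
    B (x + c • y) (x + c • y) = B x x + 2 * c * B x y + c ^ 2 * B y y := by
  have hsmul (z : L) : B (c • y) z = c * B z y := by
    rw [hsymm, map_zsmul, smul_eq_mul]
  simp only [map_add, LinearMap.add_apply, hsmul, hsymm _ (c • y)]
  ring

theorem IsScreener.ne_zero {L : Type*} [AddCommGroup L] [Module ℤ L]
    {B : L →ₗ[ℤ] L →ₗ[ℤ] ℤ} {β : L} (hβ : IsScreener B β) : β ≠ 0 := by
  rintro rfl
  exact hβ.2.1 ⟨0, (zsmul_zero _).symm⟩

/-- A vector `x + c • y` of non-positive norm vanishes. -/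
theorem eq_neg_smul_of_norm_nonpos {L : Type*} [AddCommGroup L] [Module ℤ L]
    (B : L →ₗ[ℤ] L →ₗ[ℤ] ℤ) (hsymm : ∀ x y : L, B x y = B y x)
    (hpos : ∀ x : L, x ≠ 0 → 0 < B x x) (x y : L) (c : ℤ)
    (h : B x x + 2 * c * B x y + c ^ 2 * B y y ≤ 0) : x = (-c) • y := by
  rw [← bilin_add_smul_self B hsymm] at h
  by_contra hne
  refine h.not_gt (hpos _ fun h0 => hne ?_)
  rw [neg_zsmul]
  exact eq_neg_of_add_eq_zero_left h0

theorem norm_add_smul_nonneg {L : Type*} [AddCommGroup L] [Module ℤ L]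
    (B : L →ₗ[ℤ] L →ₗ[ℤ] ℤ) (hsymm : ∀ x y : L, B x y = B y x)
    (hpos : ∀ x : L, x ≠ 0 → 0 < B x x) (x y : L) (c : ℤ) :
    0 ≤ B x x + 2 * c * B x y + c ^ 2 * B y y := by
  rw [← bilin_add_smul_self B hsymm]
  rcases eq_or_ne (x + c • y) 0 with h | h
  · simp [h]
  · exact (hpos _ h).le

/-- If `2⟨β,α⟩ = ε⟨β,β⟩` for a sign `ε`, then `⟨β,β⟩` is one, two or three times `⟨α,α⟩`. -/
theorem IsScreener.norm_ratio {L : Type*} [AddCommGroup L] [Module ℤ L]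
    {B : L →ₗ[ℤ] L →ₗ[ℤ] ℤ} (hsymm : ∀ x y : L, B x y = B y x)
    (hpos : ∀ x : L, x ≠ 0 → 0 < B x x) {α β : L}
    (hα : IsScreener B α) (hβ : IsScreener B β) {ε : ℤ} (hε : ε = 1 ∨ ε = -1)
    (h : 2 * B β α = ε * B β β) :
    ∃ a : ℤ, (a = 1 ∨ a = 2 ∨ a = 3) ∧ B β β = a * B α α := by
  have hn := hpos α hα.ne_zero
  have hm := hpos β hβ.ne_zero
  have hdvd : B α α ∣ B β β := by
    have hd := hα.2.2 β
    rw [hsymm α β, h] at hd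
    rcases hε with rfl | rfl <;> simpa using hd
  obtain ⟨a, ha⟩ := hdvd
  have ha0 : 0 < a := by
    rw [ha] at hm
    exact pos_of_mul_pos_right hm hn.le
  have ha4 : a < 4 := by
    by_contra! h4
    have hmn : 4 * B α α ≤ B β β := by rw [ha]; nlinarith
    refine hβ.2.1 ⟨ε • α, ?_⟩
    have key := eq_neg_smul_of_norm_nonpos B hsymm hpos β α (-(2 * ε)) (by
      rcases hε with rfl | rfl <;> linarith)
    rw [key, neg_neg, mul_zsmul]
  exact ⟨a, by omega, by rw [ha, mul_comm]⟩

/-- For screeners `α, β` with `⟨α,α⟩ ≤ ⟨β,β⟩`, exactly one of: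
(i) `⟨α,β⟩ = 0`; (ii) `⟨α,β⟩ = ε⟨β,β⟩` and `α = εβ` for a sign `ε`; (iii)
`2⟨α,β⟩ = ±⟨β,β⟩` and `⟨β,β⟩ = a⟨α,α⟩` with `a ∈ {1,2,3}`. -/
theorem screener_pairing_trichotomy
    (L : Type*) [AddCommGroup L] [Module ℤ L]
    [Module.Free ℤ L] [Module.Finite ℤ L]
    (B : L →ₗ[ℤ] L →ₗ[ℤ] ℤ) (hsymm : ∀ x y : L, B x y = B y x)
    (hpos : ∀ x : L, x ≠ 0 → 0 < B x x)
    (α β : L) (hα : IsScreener B α) (hβ : IsScreener B β)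
    (hle : B α α ≤ B β β) :
    ((B α β = 0) ∧
      ¬ (∃ ε : ℤ, (ε = 1 ∨ ε = -1) ∧ B α β = ε * B β β ∧ α = ε • β) ∧
      ¬ ((2 * B α β = B β β ∨ 2 * B α β = - B β β) ∧
          ∃ a : ℤ, (a = 1 ∨ a = 2 ∨ a = 3) ∧ B β β = a * B α α)) ∨
    (¬ (B α β = 0) ∧
      (∃ ε : ℤ, (ε = 1 ∨ ε = -1) ∧ B α β = ε * B β β ∧ α = ε • β) ∧
      ¬ ((2 * B α β = B β β ∨ 2 * B α β = - B β β) ∧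
          ∃ a : ℤ, (a = 1 ∨ a = 2 ∨ a = 3) ∧ B β β = a * B α α)) ∨
    (¬ (B α β = 0) ∧
      ¬ (∃ ε : ℤ, (ε = 1 ∨ ε = -1) ∧ B α β = ε * B β β ∧ α = ε • β) ∧
      ((2 * B α β = B β β ∨ 2 * B α β = - B β β) ∧
          ∃ a : ℤ, (a = 1 ∨ a = 2 ∨ a = 3) ∧ B β β = a * B α α)) := by
  have hn := hpos α hα.ne_zero
  have hm := hpos β hβ.ne_zero
  have hplus := norm_add_smul_nonneg B hsymm hpos α β 1
  have hminus := norm_add_smul_nonneg B hsymm hpos α β (-1)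
  have hratio := fun ε hε => IsScreener.norm_ratio hsymm hpos hα hβ (ε := ε) hε
  have hsign := eq_neg_smul_of_norm_nonpos B hsymm hpos α β
  obtain ⟨k, hk⟩ := hβ.2.2 α
  rw [hsymm β α] at hk
  simp only [hsymm β α] at hratio
  have hk2 : k ≤ 2 := by nlinarith
  have hk2' : -2 ≤ k := by nlinarith
  have hdisj : ∀ ε : ℤ, ε = 1 ∨ ε = -1 → B α β = ε * B β β →
      ¬ (2 * B α β = B β β ∨ 2 * B α β = - B β β) := by
    rintro ε (rfl | rfl) h <;> omega
  have hunit : ∀ ε : ℤ, ε = 1 ∨ ε = -1 → B α β = ε * B β β → B α β ≠ 0 := by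
    rintro ε (rfl | rfl) h <;> omega
  have hcases : B α β = 0 ∨
      (∃ ε : ℤ, (ε = 1 ∨ ε = -1) ∧ B α β = ε * B β β ∧ α = ε • β) ∨
      ((2 * B α β = B β β ∨ 2 * B α β = - B β β) ∧
        ∃ a : ℤ, (a = 1 ∨ a = 2 ∨ a = 3) ∧ B β β = a * B α α) := by
    interval_cases k
    · exact .inr (.inl ⟨-1, .inr rfl, by linarith, hsign 1 (by linarith)⟩)
    · exact .inr (.inr ⟨.inr (by linarith), hratio (-1) (.inr rfl) (by linarith)⟩)
    · exact .inl (by linarith)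
    · exact .inr (.inr ⟨.inl (by linarith), hratio 1 (.inl rfl) (by linarith)⟩)
    · exact .inr (.inl ⟨1, .inl rfl, by linarith, by simpa using hsign (-1) (by linarith)⟩)
  rcases hcases with h | h | h
  · refine .inl ⟨h, ?_, ?_⟩
    · rintro ⟨ε, hε, he, -⟩
      exact hunit ε hε he h
    · rintro ⟨h2, -⟩
      omega
  · obtain ⟨ε, hε, he, hs⟩ := h
    exact .inr (.inl ⟨hunit ε hε he, ⟨ε, hε, he, hs⟩, fun h => hdisj ε hε he h.1⟩)
  · refine .inr (.inr ⟨?_, ?_, h⟩)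
    · have := h.1
      omega
    · rintro ⟨ε, hε, he, -⟩
      exact hdisj ε hε he h.1
end

section
/- Let L be a positive definite integral lattice and let α, β ∈ L be screeners with ⟨α, α⟩ ≤ ⟨β, β⟩. If 2⟨α, β⟩ = −⟨β, β⟩, then α + β is a screener. -/
/-- If `α, β` are screeners with `⟨α,α⟩ ≤ ⟨β,β⟩` and
`2⟨α,β⟩ = -⟨β,β⟩`, then `α + β` is a screener. -/
theorem screener_sum
    (L : Type*) [AddCommGroup L] [Module ℤ L]
    [Module.Free ℤ L] [Module.Finite ℤ L]
    (B : L →ₗ[ℤ] L →ₗ[ℤ] ℤ) (hsymm : ∀ x y : L, B x y = B y x)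
    (hpos : ∀ x : L, x ≠ 0 → 0 < B x x)
    (α β : L) (hα : IsScreener B α) (hβ : IsScreener B β)
    (hle : B α α ≤ B β β) (hpair : 2 * B α β = - B β β) :
    IsScreener B (α + β) := by
  obtain ⟨hαe, -, hαd⟩ := hα
  obtain ⟨-, hβn, hβd⟩ := hβ
  have hnorm : B (α + β) (α + β) = B α α := by
    simp only [map_add, LinearMap.add_apply]
    linarith [hsymm β α]
  have hdvd : B α α ∣ B β β := by
    simpa [hpair] using hαd β
  refine ⟨hnorm ▸ hαe, ?_, fun γ => ?_⟩
  · rintro ⟨γ, hγ⟩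
    have hβ0 : β ≠ 0 := fun h => hβn ⟨0, by rw [h, zsmul_zero]⟩
    have hb := hpos β hβ0
    have hβγ : 2 * B β γ = B β α + B β β := by
      rw [← map_add, hγ, map_zsmul, smul_eq_mul]
    obtain ⟨k, hk⟩ := hβd γ
    have hprod : B β β * (2 * k - 1) = 0 := by
      linarith [hsymm β α]
    rcases mul_eq_zero.mp hprod with h | h <;> omega
  · rw [hnorm, map_add, LinearMap.add_apply, mul_add]
    exact dvd_add (hαd γ) (hdvd.trans (hβd γ))
end

section
/- Let L be a positive definite integral lattice and let α, β ∈ L be screeners with ⟨α, α⟩ ≤ ⟨β, β⟩ and ⟨α, β⟩ = 0. Then α + β is a screener if and only if the following three conditions hold: ⟨α, α⟩ = ⟨β, β⟩; ⟨α, α⟩ divides ⟨α + β, γ⟩ for every γ ∈ L; and α + β ∉ 2L. The same equivalence holds with α + β replaced by α − β. -/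
/-- The sum of two orthogonal vectors with `0 < ⟨x,x⟩ ≤ ⟨y,y⟩` is a screener iff the norms agree,
the common norm divides all `⟨x + y, γ⟩`, and `x + y ∉ 2L`. -/
theorem isScreener_add_iff_of_orthogonal {L : Type*} [AddCommGroup L] [Module ℤ L]
    (B : L →ₗ[ℤ] L →ₗ[ℤ] ℤ) {x y : L} (hxy : B x y = 0) (hyx : B y x = 0)
    (hpos : 0 < B x x) (hle : B x x ≤ B y y) :
    IsScreener B (x + y) ↔
      B x x = B y y ∧ (∀ γ : L, B x x ∣ B (x + y) γ) ∧ ¬ ∃ γ : L, x + y = (2 : ℤ) • γ := by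
  have hnorm : B (x + y) (x + y) = B x x + B y y := by
    simp [hxy, hyx]
  have hdvd (h : B x x = B y y) (γ : L) :
      B (x + y) (x + y) ∣ 2 * B (x + y) γ ↔ B x x ∣ B (x + y) γ := by
    rw [hnorm, ← h, ← two_mul]
    exact mul_dvd_mul_iff_left two_ne_zero
  constructor
  · rintro ⟨-, h2, h3⟩
    have heq : B x x = B y y := by
      have h := h3 y
      rw [hnorm, map_add, LinearMap.add_apply, hxy, zero_add] at h
      obtain ⟨k, hk⟩ := h
      have hk0 : 0 < k := by nlinarith
      have hk2 : k < 2 := by nlinarith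
      obtain rfl : k = 1 := by omega
      linarith
    exact ⟨heq, fun γ => (hdvd heq γ).1 (h3 γ), h2⟩
  · rintro ⟨heq, h, h2⟩
    exact ⟨⟨B x x, by rw [hnorm, ← heq]⟩, h2, fun γ => (hdvd heq γ).2 (h γ)⟩

/-- For orthogonal screeners `α, β` with `⟨α,α⟩ ≤ ⟨β,β⟩`:  `α ± β` is a
screener iff `⟨α,α⟩ = ⟨β,β⟩`, `⟨α,α⟩ ∣ ⟨α ± β, γ⟩` for all `γ`, and `α ± β ∉ 2L`. -/
theorem screener_orthogonal_sum_iff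
    (L : Type*) [AddCommGroup L] [Module ℤ L]
    [Module.Free ℤ L] [Module.Finite ℤ L]
    (B : L →ₗ[ℤ] L →ₗ[ℤ] ℤ) (hsymm : ∀ x y : L, B x y = B y x)
    (hpos : ∀ x : L, x ≠ 0 → 0 < B x x)
    (α β : L) (hα : IsScreener B α) (hβ : IsScreener B β)
    (hle : B α α ≤ B β β) (horth : B α β = 0) :
    (IsScreener B (α + β) ↔
      (B α α = B β β ∧ (∀ γ : L, B α α ∣ B (α + β) γ) ∧
        ¬ ∃ γ : L, α + β = (2 : ℤ) • γ)) ∧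
    (IsScreener B (α - β) ↔
      (B α α = B β β ∧ (∀ γ : L, B α α ∣ B (α - β) γ) ∧
        ¬ ∃ γ : L, α - β = (2 : ℤ) • γ)) := by
  have hα0 : 0 < B α α := hpos α hα.ne_zero
  have horth' : B β α = 0 := (hsymm β α).trans horth
  refine ⟨isScreener_add_iff_of_orthogonal B horth horth' hα0 hle, ?_⟩
  have hneg : B (-β) (-β) = B β β := by simp
  rw [sub_eq_add_neg, ← hneg]
  exact isScreener_add_iff_of_orthogonal B (by simp [horth]) (by simp [horth']) hα0
    (hle.trans_eq hneg.symm)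
end

section
/- Let G be a symmetric positive definite 2 × 2 integer matrix, and suppose the lattice L_G = ℤ² with bilinear form ⟨x, y⟩ = xᵀ G y has at least one screener. Then there exist A ∈ GL₂(ℤ) and positive integers p, m such that either A G Aᵀ is the diagonal matrix with diagonal entries (2p, m) and m ≠ 2p, or A G Aᵀ is the matrix with rows (2p, −p) and (−p, m) and m ≥ p. -/
open Matrix

/-- The bilinear form `⟨x, y⟩ = xᵀ G y` on `ℤⁿ` attached to a Gram matrix `G`. -/
def gForm {n : ℕ} (G : Matrix (Fin n) (Fin n) ℤ) (x y : Fin n → ℤ) : ℤ :=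
  x ⬝ᵥ (G *ᵥ y)

/-- `β ∈ ℤⁿ` is a *screener* of the lattice with Gram matrix `G` if `⟨β,β⟩` is even,
`β ∉ 2ℤⁿ`, and `⟨β,β⟩ ∣ 2⟨β,γ⟩` for every `γ`. -/
def IsScreenerM {n : ℕ} (G : Matrix (Fin n) (Fin n) ℤ) (β : Fin n → ℤ) : Prop :=
  Even (gForm G β β) ∧ (¬ ∃ γ : Fin n → ℤ, β = (2 : ℤ) • γ) ∧
    ∀ γ : Fin n → ℤ, gForm G β β ∣ 2 * gForm G β γ

/-- A positive definite binary form `2p x² + 2b xy + c y²` with `p ∣ b` is equivalent to one of the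
two normal forms. -/
theorem exists_normal_form_of_dvd {p b c : ℤ} (hp : 0 < p) (hb : p ∣ b) (hdet : b ^ 2 < 2 * p * c) :
    ∃ (A : Matrix (Fin 2) (Fin 2) ℤ) (q m : ℤ), IsUnit A.det ∧ 0 < q ∧ 0 < m ∧
      ((A * !![2*p, b; b, c] * Aᵀ = !![2*q, 0; 0, m] ∧ m ≠ 2*q) ∨
       (A * !![2*p, b; b, c] * Aᵀ = !![2*q, -q; -q, m] ∧ q ≤ m)) := by
  obtain ⟨k, rfl⟩ := hb
  rcases Int.even_or_odd' k with ⟨j, rfl | rfl⟩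
  · obtain ⟨m, hm⟩ : ∃ m, m = c - 2 * p * j ^ 2 := ⟨_, rfl⟩
    obtain rfl : c = m + 2 * p * j ^ 2 := by linarith
    have hm0 : 0 < m := by
      have : 0 < p * m := by nlinarith
      exact (pos_iff_pos_of_mul_pos this).mp hp
    by_cases h : m = 2 * p
    · refine ⟨!![1 - j, 1; j, -1], 2 * p, m, ?_, by omega, hm0, Or.inr ⟨?_, h.ge⟩⟩
      · rw [det_fin_two_of, Int.isUnit_iff]
        right; ring
      · subst h
        ext i l
        fin_cases i <;> fin_cases l <;> simp [Matrix.mul_apply, Fin.sum_univ_two] <;> ring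
    · refine ⟨!![1, 0; -j, 1], p, m, by simp [det_fin_two_of], hp, hm0, Or.inl ⟨?_, h⟩⟩
      ext i l
      fin_cases i <;> fin_cases l <;> simp [Matrix.mul_apply, Fin.sum_univ_two] <;> ring
  · obtain ⟨m, hm⟩ : ∃ m, m = c - 2 * p * (j + 1) * j := ⟨_, rfl⟩
    obtain rfl : c = m + 2 * p * (j + 1) * j := by linarith
    have hm0 : p < 2 * m := by
      have : 0 < p * (2 * m - p) := by nlinarith
      have := (pos_iff_pos_of_mul_pos this).mp hp
      linarith
    by_cases h : p ≤ m
    · refine ⟨!![1, 0; -(j + 1), 1], p, m, by simp [det_fin_two_of], hp, by omega,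
        Or.inr ⟨?_, h⟩⟩
      ext i l
      fin_cases i <;> fin_cases l <;> simp [Matrix.mul_apply, Fin.sum_univ_two] <;> ring
    · refine ⟨!![1 - 2 * (j + 1), 2; j + 1, -1], 2 * m - p, m, ?_, by omega, by omega,
        Or.inr ⟨?_, by omega⟩⟩
      · rw [det_fin_two_of, Int.isUnit_iff]
        right; ring
      · ext i l
        fin_cases i <;> fin_cases l <;> simp [Matrix.mul_apply, Fin.sum_univ_two] <;> ring

theorem gForm_fin_two (G : Matrix (Fin 2) (Fin 2) ℤ) (x y : Fin 2 → ℤ) :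
    gForm G x y = x 0 * (G 0 0 * y 0 + G 0 1 * y 1) + x 1 * (G 1 0 * y 0 + G 1 1 * y 1) := by
  simp [gForm, dotProduct, mulVec, Fin.sum_univ_two]

theorem gForm_smul_left {n : ℕ} (G : Matrix (Fin n) (Fin n) ℤ) (k : ℤ) (x y : Fin n → ℤ) :
    gForm G (k • x) y = k * gForm G x y := by
  rw [gForm, smul_dotProduct, smul_eq_mul, gForm]

theorem gForm_smul_right {n : ℕ} (G : Matrix (Fin n) (Fin n) ℤ) (k : ℤ) (x y : Fin n → ℤ) :
    gForm G x (k • y) = k * gForm G x y := by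
  rw [gForm, mulVec_smul, dotProduct_smul, smul_eq_mul, gForm]

/-- A vector some integer multiple of which is a screener is itself a screener. -/
theorem IsScreenerM.of_smul {n : ℕ} {G : Matrix (Fin n) (Fin n) ℤ} {k : ℤ} {β : Fin n → ℤ}
    (h : IsScreenerM G (k • β)) : IsScreenerM G β := by
  obtain ⟨heven, hodd, hdvd⟩ := h
  have hk : Odd k := by
    rw [← Int.not_even_iff_odd]
    rintro ⟨l, rfl⟩
    exact hodd ⟨l • β, by rw [smul_smul, two_mul]⟩
  have hk0 : k ≠ 0 := by rintro rfl; simp at hk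
  simp only [gForm_smul_left, gForm_smul_right] at heven hdvd
  refine ⟨?_, ?_, fun γ => ?_⟩
  · simpa [Int.even_mul, Int.not_even_iff_odd.mpr hk] using heven
  · rintro ⟨γ, rfl⟩
    exact hodd ⟨k • γ, smul_comm _ _ _⟩
  · have h := hdvd γ
    rw [mul_left_comm 2] at h
    exact (dvd_mul_left _ _).trans (Int.dvd_of_mul_dvd_mul_left hk0 h)

/-- A lattice of rank two with a screener has one with coprime coordinates. -/
theorem IsScreenerM.exists_isCoprime {G : Matrix (Fin 2) (Fin 2) ℤ} {β : Fin 2 → ℤ}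
    (h : IsScreenerM G β) : ∃ γ, IsScreenerM G γ ∧ IsCoprime (γ 0) (γ 1) := by
  have hgcd : 0 < Int.gcd (β 0) (β 1) := by
    rw [Nat.pos_iff_ne_zero, Ne, Int.gcd_eq_zero_iff]
    rintro ⟨h0, h1⟩
    exact h.2.1 ⟨0, by ext i; fin_cases i <;> simp [h0, h1]⟩
  obtain ⟨a, b, hab, ha, hb⟩ := Int.exists_gcd_one hgcd
  refine ⟨![a, b], IsScreenerM.of_smul (k := Int.gcd (β 0) (β 1)) ?_,
    by simpa [Int.isCoprime_iff_gcd_eq_one] using hab⟩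
  convert h using 1
  ext i
  fin_cases i
  · simpa [mul_comm] using ha.symm
  · simpa [mul_comm] using hb.symm

/-- A symmetric positive definite 2×2 integral Gram matrix whose lattice
has at least one screener is `GL₂(ℤ)`-equivalent to `diag(2p, m)` with `m ≠ 2p`, or to
`[[2p, -p], [-p, m]]` with `m ≥ p`, for some positive integers `p, m`. -/
theorem rank_two_gram_normal_form
    (G : Matrix (Fin 2) (Fin 2) ℤ) (hsymm : G.IsSymm)
    (hpos : ∀ x : Fin 2 → ℤ, x ≠ 0 → 0 < gForm G x x)
    (hscr : ∃ β : Fin 2 → ℤ, IsScreenerM G β) :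
    ∃ (A : Matrix (Fin 2) (Fin 2) ℤ) (p m : ℤ), IsUnit A.det ∧ 0 < p ∧ 0 < m ∧
      ((A * G * Aᵀ = !![2*p, 0; 0, m] ∧ m ≠ 2*p) ∨
       (A * G * Aᵀ = !![2*p, -p; -p, m] ∧ p ≤ m)) := by
  obtain ⟨β₀, hβ₀⟩ := hscr
  obtain ⟨β, ⟨heven, hodd, hdvd⟩, u, v, huv⟩ := hβ₀.exists_isCoprime
  have h10 : G 1 0 = G 0 1 := hsymm.apply 0 1
  have hβpos : 0 < gForm G β β := hpos β fun h => hodd ⟨0, by simp [h]⟩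
  have hG : G 0 1 ^ 2 < G 0 0 * G 1 1 := by
    have h00 : 0 < G 0 0 := by
      simpa [gForm_fin_two] using hpos ![1, 0] (fun h => by simpa using congrFun h 0)
    have h := hpos ![G 0 1, -G 0 0] (fun h => h00.ne' (by simpa using congrFun h 1))
    simp only [gForm_fin_two, h10, cons_val_zero, cons_val_one] at h
    nlinarith
  obtain ⟨p, hp⟩ := heven.two_dvd
  obtain ⟨γ, hγ⟩ : ∃ γ : Fin 2 → ℤ, γ = ![-v, u] := ⟨_, rfl⟩
  have hγ0 : γ 0 = -v := by simp [hγ]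
  have hγ1 : γ 1 = u := by simp [hγ]
  have hbasis : !![β 0, β 1; γ 0, γ 1] * G * !![β 0, β 1; γ 0, γ 1]ᵀ
      = !![2 * p, gForm G β γ; gForm G β γ, gForm G γ γ] := by
    rw [← hp]
    ext i l
    fin_cases i <;> fin_cases l <;>
      simp [Matrix.mul_apply, vecMul, dotProduct, Fin.sum_univ_two, gForm_fin_two, h10] <;> ring
  have hunit : !![β 0, β 1; γ 0, γ 1].det = 1 := by
    rw [det_fin_two_of, hγ0, hγ1]
    linarith
  have hdet : gForm G β γ ^ 2 < 2 * p * gForm G γ γ := by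
    have h := congrArg det hbasis
    rw [det_mul, det_mul, det_transpose, hunit, det_fin_two, det_fin_two_of, h10] at h
    nlinarith
  have hpγ : p ∣ gForm G β γ := by
    have h := hdvd γ
    rw [hp] at h
    exact Int.dvd_of_mul_dvd_mul_left two_ne_zero h
  obtain ⟨A, q, m, hA, hq, hm, h⟩ := exists_normal_form_of_dvd (by omega) hpγ hdet
  refine ⟨A * !![β 0, β 1; γ 0, γ 1], q, m, by rwa [det_mul, hunit, mul_one], hq, hm, ?_⟩
  simpa only [transpose_mul, ← hbasis, Matrix.mul_assoc] using h
end

section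
/- Let p, m be positive integers with m ≠ 2p, and let L be the lattice ℤ² with bilinear form ⟨x, y⟩ = 2p·x₁y₁ + m·x₂y₂ (Gram matrix diag(2p, m) with respect to the standard basis e₁, e₂). If m is odd, then the set of screeners of L is exactly {e₁, −e₁}; if m is even, then the set of screeners of L is exactly {e₁, −e₁, e₂, −e₂}. -/
open Matrix

theorem gForm_diag_two (a b : ℤ) (x y : Fin 2 → ℤ) :
    gForm !![a, 0; 0, b] x y = a * x 0 * y 0 + b * x 1 * y 1 := by
  simp [gForm, Matrix.mulVec, dotProduct, Fin.sum_univ_two]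
  ring

theorem isScreenerM_diag_two_iff (a b : ℤ) (x : Fin 2 → ℤ) :
    IsScreenerM !![a, 0; 0, b] x ↔
      Even (a * x 0 ^ 2 + b * x 1 ^ 2) ∧ ¬ (2 ∣ x 0 ∧ 2 ∣ x 1) ∧
        a * x 0 ^ 2 + b * x 1 ^ 2 ∣ 2 * (a * x 0) ∧
        a * x 0 ^ 2 + b * x 1 ^ 2 ∣ 2 * (b * x 1) := by
  have hN : gForm !![a, 0; 0, b] x x = a * x 0 ^ 2 + b * x 1 ^ 2 := by
    rw [gForm_diag_two]
    ring
  have hdouble : (∃ γ : Fin 2 → ℤ, x = (2 : ℤ) • γ) ↔ 2 ∣ x 0 ∧ 2 ∣ x 1 := by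
    constructor
    · rintro ⟨γ, rfl⟩
      simp
    · rintro ⟨⟨c, hc⟩, ⟨d, hd⟩⟩
      refine ⟨![c, d], ?_⟩
      ext i
      fin_cases i <;> simp [hc, hd]
  unfold IsScreenerM
  rw [hN, hdouble]
  refine and_congr_right fun _ => and_congr_right fun _ => ⟨fun h => ⟨?_, ?_⟩, ?_⟩
  · simpa [gForm_diag_two] using h ![1, 0]
  · simpa [gForm_diag_two] using h ![0, 1]
  · rintro ⟨h₀, h₁⟩ γ
    rw [gForm_diag_two]
    have h := dvd_add (h₀.mul_right (γ 0)) (h₁.mul_right (γ 1))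
    ring_nf at h ⊢
    exact h

/-- In an orthogonal sum of two rank one lattices of distinct positive norms, a vector
satisfying the divisibility condition of a screener lies on one of the axes. -/
theorem eq_zero_or_eq_zero_of_dvd {a b u v : ℤ} (ha : 0 < a) (hb : 0 < b) (hab : b ≠ a)
    (hu : a * u ^ 2 + b * v ^ 2 ∣ 2 * (a * u)) (hv : a * u ^ 2 + b * v ^ 2 ∣ 2 * (b * v)) :
    u = 0 ∨ v = 0 := by
  by_contra! h
  obtain ⟨hu0, hv0⟩ := h
  obtain ⟨k, hk⟩ := hu
  obtain ⟨l, hl⟩ := hv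
  have hu2 : 0 < a * u ^ 2 := by positivity
  have hv2 : 0 < b * v ^ 2 := by positivity
  have hN : 0 < a * u ^ 2 + b * v ^ 2 := by positivity
  have hku : (a * u ^ 2 + b * v ^ 2) * (k * u) = 2 * (a * u ^ 2) := by
    linear_combination -u * hk
  have hlv : (a * u ^ 2 + b * v ^ 2) * (l * v) = 2 * (b * v ^ 2) := by
    linear_combination -v * hl
  have hsum : k * u + l * v = 2 :=
    mul_left_cancel₀ hN.ne' (by linear_combination hku + hlv)
  have hku_pos : 0 < k * u := pos_of_mul_pos_right (by rw [hku]; positivity) hN.le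
  have hlv_pos : 0 < l * v := pos_of_mul_pos_right (by rw [hlv]; positivity) hN.le
  have hku_one : k * u = 1 := by omega
  have hlv_one : v * l = 1 := by linarith
  have hu_sq : u ^ 2 = 1 := by
    rcases Int.eq_one_or_neg_one_of_mul_eq_one (by linarith : u * k = 1) with rfl | rfl <;> rfl
  have hv_sq : v ^ 2 = 1 := by
    rcases Int.eq_one_or_neg_one_of_mul_eq_one hlv_one with rfl | rfl <;> rfl
  rw [hku_one, hu_sq, hv_sq] at hku
  exact hab (by linarith)

theorem eq_one_or_eq_neg_one_of_mul_sq_dvd {a u : ℤ} (ha : a ≠ 0) (hu : ¬ 2 ∣ u)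
    (h : a * u ^ 2 ∣ 2 * (a * u)) : u = 1 ∨ u = -1 := by
  have hu0 : u ≠ 0 := by
    rintro rfl
    simp at hu
  have hdvd : u ∣ 2 := by
    rw [show a * u ^ 2 = a * u * u by ring, mul_comm 2] at h
    exact Int.dvd_of_mul_dvd_mul_left (mul_ne_zero ha hu0) h
  have hle := Int.le_of_dvd two_pos hdvd
  have hge := Int.le_of_dvd two_pos ((neg_dvd).mpr hdvd)
  omega

/-- The screeners of `diag(a, b)` with `a` even, `a, b > 0` and `a ≠ b`. -/
theorem isScreenerM_diag_two_iff_of_even {a b : ℤ} (ha : 0 < a) (hb : 0 < b) (hab : b ≠ a)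
    (hae : Even a) (x : Fin 2 → ℤ) :
    IsScreenerM !![a, 0; 0, b] x ↔
      (x = ![1, 0] ∨ x = ![-1, 0]) ∨ Even b ∧ (x = ![0, 1] ∨ x = ![0, -1]) := by
  rw [isScreenerM_diag_two_iff]
  constructor
  · rintro ⟨he, hnd, h₀, h₁⟩
    have hx : x = ![x 0, x 1] := by
      ext i
      fin_cases i <;> rfl
    generalize x 0 = u at *
    generalize x 1 = v at *
    subst hx
    rcases eq_zero_or_eq_zero_of_dvd ha hb hab h₀ h₁ with rfl | rfl
    · right
      rcases eq_one_or_eq_neg_one_of_mul_sq_dvd hb.ne' (by simpa using hnd)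
        (by simpa using h₁) with rfl | rfl <;> simpa using he
    · left
      rcases eq_one_or_eq_neg_one_of_mul_sq_dvd ha.ne' (by simpa using hnd)
        (by simpa using h₀) with rfl | rfl <;> simp
  · rintro ((rfl | rfl) | ⟨hbe, rfl | rfl⟩) <;> simp [*]

/-- For the lattice `ℤ²` with Gram matrix `diag(2p, m)` (`p, m > 0`,
`m ≠ 2p`): if `m` is odd, the screeners are exactly `±e₁`; if `m` is even, the
screeners are exactly `±e₁, ±e₂`. -/
theorem type_one_screener_classification
    (p m : ℤ) (hp : 0 < p) (hm : 0 < m) (hne : m ≠ 2*p) :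
    (Odd m → ∀ β : Fin 2 → ℤ,
      IsScreenerM !![2*p, 0; 0, m] β ↔ (β = ![1, 0] ∨ β = ![-1, 0])) ∧
    (Even m → ∀ β : Fin 2 → ℤ,
      IsScreenerM !![2*p, 0; 0, m] β ↔
        (β = ![1, 0] ∨ β = ![-1, 0] ∨ β = ![0, 1] ∨ β = ![0, -1])) := by
  have key := isScreenerM_diag_two_iff_of_even (a := 2 * p) (by positivity) hm hne
    (even_two_mul p)
  refine ⟨fun hodd β => ?_, fun heven β => ?_⟩
  · simp [key, Int.not_even_iff_odd.mpr hodd]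
  · simp [key, heven, or_assoc]
end

section
/- Let p, m be positive integers with m ≥ p, m ≠ p, and m ≠ 2p, and let L be the lattice ℤ² with bilinear form given by the Gram matrix with rows (2p, −p) and (−p, m) with respect to the standard basis e₁, e₂. Then the set of screeners of L is exactly {e₁, −e₁, e₁ + 2e₂, −(e₁ + 2e₂)}; here ⟨e₁, e₁⟩ = 2p and ⟨e₁ + 2e₂, e₁ + 2e₂⟩ = 4m − 2p. -/
open Matrix

/-- Arithmetic core of the classification: the two divisibilities obtained by pairing `(x, y)`
with the standard basis leave only four vectors. -/
theorem eq_of_norm_dvd_of_norm_dvd {p m x y : ℤ} (hp : 0 < p) (hpm : p < m) (h2 : m ≠ 2 * p)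
    (hne : ¬ (x = 0 ∧ y = 0))
    (d₁ : 2 * p * x ^ 2 - 2 * p * x * y + m * y ^ 2 ∣ 2 * p * (2 * x - y))
    (d₂ : 2 * p * x ^ 2 - 2 * p * x * y + m * y ^ 2 ∣ 2 * (m * y - p * x)) :
    (x = 1 ∧ y = 0) ∨ (x = -1 ∧ y = 0) ∨ (x = 1 ∧ y = 2) ∨ (x = -1 ∧ y = -2) := by
  rcases eq_or_ne (2 * x - y) 0 with hu | hu
  · obtain rfl : y = 2 * x := by linarith
    have hx : x ≠ 0 := fun h => hne ⟨h, by simp [h]⟩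
    have hd : (2 * (2 * m - p) * x) * x ∣ (2 * (2 * m - p) * x) * 1 := by
      convert d₂ using 1 <;> ring
    have hd' := Int.dvd_of_mul_dvd_mul_left (mul_ne_zero (by linarith) hx) hd
    rcases Int.isUnit_iff.1 (isUnit_of_dvd_one hd') with rfl | rfl <;> simp
  rcases eq_or_ne y 0 with rfl | hy
  · have hx : x ≠ 0 := fun h => hne ⟨h, rfl⟩
    have hd : (2 * p * x) * x ∣ (2 * p * x) * (-1) := by
      convert d₂ using 1 <;> ring
    have hd' := Int.dvd_of_mul_dvd_mul_left (mul_ne_zero (by linarith) hx) hd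
    rcases Int.isUnit_iff.1 (isUnit_of_dvd_one (dvd_neg.1 hd')) with rfl | rfl <;> simp
  exfalso
  obtain ⟨u, rfl⟩ : ∃ u, y = 2 * x - u := ⟨2 * x - y, by ring⟩
  have hu0 : u ≠ 0 := by simpa using hu
  obtain ⟨c, hc⟩ : 2 * p * x ^ 2 - 2 * p * x * (2 * x - u) + m * (2 * x - u) ^ 2 ∣
      2 * p * |u| := by
    rw [← abs_of_pos (show 0 < 2 * p by linarith), ← abs_mul, dvd_abs,
      abs_of_pos (show 0 < 2 * p by linarith)]
    simpa using d₁
  have habs : 0 < |u| := abs_pos.2 hu0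
  have hle := Int.le_of_dvd (by positivity) (Dvd.intro c hc.symm)
  have hy1 : 1 ≤ (2 * x - u) ^ 2 := by
    have := sq_pos_of_ne_zero hy
    linarith
  have hylt : (2 * x - u) ^ 2 < 4 := by
    nlinarith [sq_nonneg (|u| - 2), sq_abs u]
  have hysq : (2 * x - u) ^ 2 = 1 := by
    have hya : |2 * x - u| < 2 := abs_lt_of_sq_lt_sq (by linarith) (by norm_num)
    obtain ⟨hy2, hy3⟩ := abs_lt.1 hya
    obtain h | h : 2 * x - u = 1 ∨ 2 * x - u = -1 := by omega
    all_goals rw [h]; norm_num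
  have hnorm : 2 * (2 * p * x ^ 2 - 2 * p * x * (2 * x - u) + m * (2 * x - u) ^ 2) =
      p * |u| ^ 2 + (2 * m - p) := by
    rw [sq_abs]
    linear_combination (2 * m - p) * hysq
  generalize 2 * p * x ^ 2 - 2 * p * x * (2 * x - u) + m * (2 * x - u) ^ 2 = N at *
  have hlt : 2 * p * |u| < 2 * N := by nlinarith [mul_nonneg hp.le (sq_nonneg (|u| - 1))]
  have hN : 0 < N := by nlinarith
  obtain rfl : c = 1 := by
    have : 0 < c := by nlinarith
    have : c < 2 := by nlinarith
    omega
  have hult : |u| < 4 := by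
    by_contra! h
    nlinarith [mul_nonneg hp.le (mul_nonneg habs.le (sub_nonneg.2 h))]
  have hodd : Odd |u| := by
    have : Odd ((2 * x - u) ^ 2) := by rw [hysq]; exact odd_one
    have := (Int.odd_pow' two_ne_zero).1 this
    rw [odd_abs]
    rw [Int.odd_iff] at this ⊢
    omega
  obtain h | h : |u| = 1 ∨ |u| = 3 := by
    rw [Int.odd_iff] at hodd
    omega
  all_goals
    rw [h] at hc hnorm
    exact h2 (by linarith)

/-- For the lattice `ℤ²` with Gram matrix `[[2p, -p], [-p, m]]`
(`p, m > 0`, `m ≥ p`, `m ≠ p`, `m ≠ 2p`), the screeners are exactly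
`±e₁, ±(e₁ + 2e₂)`, of norms squared `2p` and `4m - 2p` respectively. -/
theorem type_two_a_screener_classification
    (p m : ℤ) (hp : 0 < p) (hm : 0 < m) (hpm : p ≤ m) (h1 : m ≠ p) (h2 : m ≠ 2*p) :
    (∀ β : Fin 2 → ℤ,
      IsScreenerM !![2*p, -p; -p, m] β ↔
        (β = ![1, 0] ∨ β = ![-1, 0] ∨ β = ![1, 2] ∨ β = ![-1, -2])) ∧
    gForm !![2*p, -p; -p, m] ![1, 0] ![1, 0] = 2*p ∧
    gForm !![2*p, -p; -p, m] ![1, 2] ![1, 2] = 4*m - 2*p := by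
  refine ⟨fun β => ⟨?_, ?_⟩, ?_, ?_⟩
  · rintro ⟨-, hprim, hdvd⟩
    have hne : ¬ (β 0 = 0 ∧ β 1 = 0) := by
      rintro ⟨h₀, h₁⟩
      refine hprim ⟨0, ?_⟩
      ext i
      fin_cases i <;> simp [h₀, h₁]
    have key := eq_of_norm_dvd_of_norm_dvd hp (lt_of_le_of_ne hpm h1.symm) h2 hne
      (by
        convert hdvd ![1, 0] using 1 <;> simp [gForm, dotProduct, mulVec, Fin.sum_univ_two] <;> ring)
      (by
        convert hdvd ![0, 1] using 1 <;> simp [gForm, dotProduct, mulVec, Fin.sum_univ_two] <;> ring)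
    simpa [funext_iff, Fin.forall_fin_two] using key
  · have hodd : ∀ {v : Fin 2 → ℤ}, Odd (v 0) → ¬ ∃ γ : Fin 2 → ℤ, v = (2 : ℤ) • γ := by
      rintro _ h ⟨γ, rfl⟩
      simp [Int.odd_iff] at h
    rintro (rfl | rfl | rfl | rfl)
    · refine ⟨⟨p, ?_⟩, hodd (by simp), fun γ => ⟨2 * γ 0 - γ 1, ?_⟩⟩ <;>
        simp [gForm, dotProduct, mulVec, Fin.sum_univ_two] <;> ring
    · refine ⟨⟨p, ?_⟩, hodd (by simp), fun γ => ⟨γ 1 - 2 * γ 0, ?_⟩⟩ <;>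
        simp [gForm, dotProduct, mulVec, Fin.sum_univ_two] <;> ring
    · refine ⟨⟨2 * m - p, ?_⟩, hodd (by simp), fun γ => ⟨γ 1, ?_⟩⟩ <;>
        simp [gForm, dotProduct, mulVec, Fin.sum_univ_two] <;> ring
    · refine ⟨⟨2 * m - p, ?_⟩, hodd (by simp), fun γ => ⟨-γ 1, ?_⟩⟩ <;>
        simp [gForm, dotProduct, mulVec, Fin.sum_univ_two] <;> ring
  · simp [gForm, dotProduct, mulVec, Fin.sum_univ_two]
  · simp [gForm, dotProduct, mulVec, Fin.sum_univ_two]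
    ring
end

section
/- Let p be a positive integer and let L be the lattice ℤ² with bilinear form given by the Gram matrix with rows (2p, −p) and (−p, 2p) with respect to the standard basis e₁, e₂ (so L = √p·A₂). Then the set of screeners of L is exactly the 12-element set {±e₁, ±e₂, ±(e₁ + e₂), ±(e₁ − e₂), ±(e₁ + 2e₂), ±(2e₁ + e₂)}; the six elements ±e₁, ±e₂, ±(e₁ + e₂) have norm squared 2p and the six elements ±(e₁ − e₂), ±(e₁ + 2e₂), ±(2e₁ + e₂) have norm squared 6p, so the screeners form a copy of the G₂ root system rescaled by √p. -/
open Matrix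

/-- The Gram matrix of `√p · A₂`. -/
def gramA2 (p : ℤ) : Matrix (Fin 2) (Fin 2) ℤ := !![2*p, -p; -p, 2*p]

theorem gForm_gramA2 (p : ℤ) (β γ : Fin 2 → ℤ) :
    gForm (gramA2 p) β γ =
      p * ((2 * β 0 - β 1) * γ 0 + (2 * β 1 - β 0) * γ 1) := by
  simp [gForm, gramA2, dotProduct, mulVec, Fin.sum_univ_two]
  ring

theorem gForm_gramA2_self (p : ℤ) (β : Fin 2 → ℤ) :
    gForm (gramA2 p) β β = 2 * p * (β 0 ^ 2 - β 0 * β 1 + β 1 ^ 2) := by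
  rw [gForm_gramA2]
  ring

theorem exists_eq_two_smul_iff (β : Fin 2 → ℤ) :
    (∃ γ : Fin 2 → ℤ, β = (2 : ℤ) • γ) ↔ 2 ∣ β 0 ∧ 2 ∣ β 1 := by
  constructor
  · rintro ⟨γ, rfl⟩
    simp
  · rintro ⟨⟨c, hc⟩, d, hd⟩
    refine ⟨![c, d], ?_⟩
    ext i
    fin_cases i <;> simp [hc, hd]

/-- The factor `p` cancels from the divisibility condition, which only has to be tested on the
standard basis. -/
theorem isScreenerM_gramA2_iff {p : ℤ} (hp : p ≠ 0) (β : Fin 2 → ℤ) :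
    IsScreenerM (gramA2 p) β ↔ ¬ (2 ∣ β 0 ∧ 2 ∣ β 1) ∧
      β 0 ^ 2 - β 0 * β 1 + β 1 ^ 2 ∣ 2 * β 0 - β 1 ∧
      β 0 ^ 2 - β 0 * β 1 + β 1 ^ 2 ∣ 2 * β 1 - β 0 := by
  have h2p : 2 * p ≠ 0 := mul_ne_zero two_ne_zero hp
  unfold IsScreenerM
  rw [exists_eq_two_smul_iff, gForm_gramA2_self]
  simp only [gForm_gramA2, ← mul_assoc 2 p, mul_dvd_mul_iff_left h2p]
  constructor
  · rintro ⟨-, h2, h⟩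
    exact ⟨h2, by simpa using h ![1, 0], by simpa using h ![0, 1]⟩
  · rintro ⟨h2, h0, h1⟩
    refine ⟨?_, h2, fun γ => dvd_add (h0.mul_right _) (h1.mul_right _)⟩
    rw [mul_assoc]
    exact even_two_mul _

/-- The integers `s = (2a - b) / q`, `t = (2b - a) / q` satisfy `q * (s² + st + t²) = 3`. -/
theorem eisensteinNorm_le_three {a b : ℤ} (h2 : ¬ (2 ∣ a ∧ 2 ∣ b))
    (h0 : a ^ 2 - a * b + b ^ 2 ∣ 2 * a - b) (h1 : a ^ 2 - a * b + b ^ 2 ∣ 2 * b - a) :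
    a ^ 2 - a * b + b ^ 2 ≤ 3 := by
  obtain ⟨s, hs⟩ := h0
  obtain ⟨t, ht⟩ := h1
  have hq : a ^ 2 - a * b + b ^ 2 ≠ 0 := by
    intro hq
    rw [hq] at hs ht
    exact h2 ⟨by omega, by omega⟩
  have hprod : (a ^ 2 - a * b + b ^ 2) * (s ^ 2 + s * t + t ^ 2) = 3 := by
    apply mul_left_cancel₀ hq
    calc
      _ = ((a ^ 2 - a * b + b ^ 2) * s) ^ 2 +
          (a ^ 2 - a * b + b ^ 2) * s * ((a ^ 2 - a * b + b ^ 2) * t) +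
          ((a ^ 2 - a * b + b ^ 2) * t) ^ 2 := by ring
      _ = _ := by
        rw [← hs, ← ht]
        ring
  exact Int.le_of_dvd (by norm_num) ⟨_, hprod.symm⟩

/-- For `L = √p·A₂` (Gram matrix `[[2p, -p], [-p, 2p]]`), the screeners
are exactly the 12 vectors `±e₁, ±e₂, ±(e₁+e₂), ±(e₁−e₂), ±(e₁+2e₂), ±(2e₁+e₂)`;
the first six have norm squared `2p` and the last six have norm squared `6p`
(a rescaled copy of the `G₂` root system). -/
theorem type_two_c_screener_classification
    (p : ℤ) (hp : 0 < p) :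
    (∀ β : Fin 2 → ℤ, IsScreenerM (gramA2 p) β ↔
      β ∈ ({![1, 0], ![-1, 0], ![0, 1], ![0, -1], ![1, 1], ![-1, -1],
            ![1, -1], ![-1, 1], ![1, 2], ![-1, -2], ![2, 1], ![-2, -1]} :
            Set (Fin 2 → ℤ))) ∧
    (∀ β ∈ ({![1, 0], ![-1, 0], ![0, 1], ![0, -1], ![1, 1], ![-1, -1]} :
            Set (Fin 2 → ℤ)), gForm (gramA2 p) β β = 2*p) ∧
    (∀ β ∈ ({![1, -1], ![-1, 1], ![1, 2], ![-1, -2], ![2, 1], ![-2, -1]} :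
            Set (Fin 2 → ℤ)), gForm (gramA2 p) β β = 6*p) := by
  refine ⟨fun β => ?_, fun β hβ => ?_, fun β hβ => ?_⟩
  · rw [isScreenerM_gramA2_iff hp.ne']
    constructor
    · rintro ⟨h2, h0, h1⟩
      have hq := eisensteinNorm_le_three h2 h0 h1
      obtain ⟨a, b, rfl⟩ : ∃ a b, β = ![a, b] := ⟨β 0, β 1, by ext i; fin_cases i <;> rfl⟩
      simp only [cons_val_zero, cons_val_one] at h2 hq
      have ha : -2 ≤ a ∧ a ≤ 2 := by
        constructor <;> nlinarith [sq_nonneg (2 * b - a)]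
      have hb : -2 ≤ b ∧ b ≤ 2 := by
        constructor <;> nlinarith [sq_nonneg (2 * a - b)]
      obtain ⟨ha₁, ha₂⟩ := ha
      obtain ⟨hb₁, hb₂⟩ := hb
      interval_cases a <;> interval_cases b <;> first | omega | simp
    · simp only [Set.mem_insert_iff, Set.mem_singleton_iff]
      rintro (rfl | rfl | rfl | rfl | rfl | rfl | rfl | rfl | rfl | rfl | rfl | rfl) <;> decide
  all_goals
    rw [gForm_gramA2_self]
    simp only [Set.mem_insert_iff, Set.mem_singleton_iff] at hβ
    rcases hβ with rfl | rfl | rfl | rfl | rfl | rfl <;>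
      simp only [cons_val_zero, cons_val_one] <;> ring
end

section
/- Let n > 3 and let L be the lattice ℤⁿ with bilinear form given by the A_n Gram matrix G, where G_{ii} = 2, G_{ij} = −1 if |i − j| = 1, and G_{ij} = 0 otherwise. Then an element β ∈ L is a screener if and only if ⟨β, β⟩ = 2; that is, the set of screeners of the root lattice A_n is exactly its set of roots. -/
open Matrix

/-- The Gram matrix of the root lattice `A_n`: `2` on the diagonal, `-1` between
consecutive indices, `0` otherwise. -/
def gramA (n : ℕ) : Matrix (Fin n) (Fin n) ℤ :=
  Matrix.of fun i j =>
    if i = j then 2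
    else if (i : ℕ) + 1 = (j : ℕ) ∨ (j : ℕ) + 1 = (i : ℕ) then -1 else 0

/-- Integers, at least five of them, with zero sum and not all zero, whose sum of squares is `2 * M`
and which are all congruent modulo `M`, exist only for `M = 1`. -/
theorem eq_one_of_sum_sq_eq_two_mul {ι : Type*} [DecidableEq ι] {s : Finset ι} (hs : 5 ≤ s.card)
    {x : ι → ℤ} {M : ℤ} (hsum : ∑ i ∈ s, x i = 0) (hne : ∃ i ∈ s, x i ≠ 0)
    (hsq : ∑ i ∈ s, x i ^ 2 = 2 * M) (hdvd : ∀ i ∈ s, ∀ j ∈ s, M ∣ x i - x j) : M = 1 := by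
  obtain ⟨i, his, hi⟩ := Finset.exists_pos_of_sum_zero_of_exists_nonzero x hsum hne
  obtain ⟨j, hjs, hj⟩ : ∃ j ∈ s, x j < 0 := by
    by_contra! h
    exact hi.ne' ((Finset.sum_eq_zero_iff_of_nonneg h).1 hsum i his)
  have hij : j ≠ i := by rintro rfl; omega
  have hjs' : j ∈ s.erase i := Finset.mem_erase.2 ⟨hij, hjs⟩
  rw [← Finset.add_sum_erase _ _ his, ← Finset.add_sum_erase _ _ hjs'] at hsq
  have hcard : 3 ≤ ((s.erase i).erase j).card := by
    rw [Finset.card_erase_of_mem hjs', Finset.card_erase_of_mem his]; omega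
  have hnonneg : 0 ≤ ∑ k ∈ (s.erase i).erase j, x k ^ 2 :=
    Finset.sum_nonneg fun k _ => sq_nonneg (x k)
  have hM : 0 < M := by nlinarith [sq_nonneg (x j)]
  by_cases hMi : M ∣ x i
  · have hMj : M ∣ x j := (dvd_sub_right hMi).1 (hdvd i his j hjs)
    have hi' : M ≤ x i := Int.le_of_dvd hi hMi
    have hj' : M ≤ -x j := Int.le_of_dvd (by omega) (dvd_neg.2 hMj)
    nlinarith
  · have hrest : (((s.erase i).erase j).card : ℤ) ≤ ∑ k ∈ (s.erase i).erase j, x k ^ 2 := by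
      rw [← nsmul_one]
      refine Finset.card_nsmul_le_sum _ _ _ fun k hk => ?_
      have hks : k ∈ s := Finset.mem_of_mem_erase (Finset.mem_of_mem_erase hk)
      have hk0 : x k ≠ 0 := fun h => hMi (by simpa [h] using hdvd i his k hks)
      have := sq_pos_of_ne_zero hk0
      omega
    have hle : M ≤ x i - x j := Int.le_of_dvd (by omega) (hdvd i his j hjs)
    have hcard' : (3 : ℤ) ≤ ((s.erase i).erase j).card := by exact_mod_cast hcard
    nlinarith [sq_nonneg (x i + x j), sq_nonneg (M - 2)]

/-- Summation by parts for the second difference of a sequence. -/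
theorem sum_range_mul_second_difference (a : ℕ → ℤ) (n : ℕ) :
    ∑ i ∈ Finset.range n, a (i + 1) * (2 * a (i + 1) - a i - a (i + 2)) =
      ∑ k ∈ Finset.range (n + 1), (a (k + 1) - a k) ^ 2 + a 0 * (a 1 - a 0)
        - a (n + 1) * (a (n + 1) - a n) := by
  induction n with
  | zero => simp; ring
  | succ n ih => rw [Finset.sum_range_succ, ih, Finset.sum_range_succ _ (n + 1)]; ring

/-- The coordinates of `β`, shifted by one and extended by zero. -/
def zeroExtend {n : ℕ} (β : Fin n → ℤ) (k : ℕ) : ℤ :=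
  if h : 0 < k ∧ k ≤ n then β ⟨k - 1, by omega⟩ else 0

@[simp]
theorem zeroExtend_val_add_one {n : ℕ} (β : Fin n → ℤ) (i : Fin n) :
    zeroExtend β (i + 1) = β i := by
  simp [zeroExtend]

@[simp]
theorem zeroExtend_zero {n : ℕ} (β : Fin n → ℤ) : zeroExtend β 0 = 0 := by
  simp [zeroExtend]

@[simp]
theorem zeroExtend_add_one {n : ℕ} (β : Fin n → ℤ) : zeroExtend β (n + 1) = 0 := by
  simp [zeroExtend]

theorem gramA_mulVec {n : ℕ} (β : Fin n → ℤ) (i : Fin n) :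
    (gramA n *ᵥ β) i =
      2 * zeroExtend β (i + 1) - zeroExtend β i - zeroExtend β (i + 2) := by
  have hterm (j : Fin n) : gramA n i j * β j =
      (if (j : ℕ) = i then 2 * zeroExtend β (j + 1) else 0)
        - (if (j : ℕ) + 1 = i then zeroExtend β (j + 1) else 0)
        - (if (j : ℕ) = i + 1 then zeroExtend β (j + 1) else 0) := by
    simp only [gramA, Matrix.of_apply, zeroExtend_val_add_one, Fin.ext_iff]
    split_ifs <;> omega
  have hi := i.isLt
  simp only [Matrix.mulVec, dotProduct, hterm, Finset.sum_sub_distrib]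
  rw [Fin.sum_univ_eq_sum_range (fun j => if j = (i : ℕ) then 2 * zeroExtend β (j + 1) else 0),
    Fin.sum_univ_eq_sum_range (fun j => if j + 1 = (i : ℕ) then zeroExtend β (j + 1) else 0),
    Fin.sum_univ_eq_sum_range (fun j => if j = (i : ℕ) + 1 then zeroExtend β (j + 1) else 0),
    Finset.sum_ite_eq', Finset.sum_ite_eq', if_pos (Finset.mem_range.2 hi)]
  congr 1
  · congr 1
    obtain h | ⟨m, hm⟩ : (i : ℕ) = 0 ∨ ∃ m, (i : ℕ) = m + 1 := by
      cases (i : ℕ) <;> simp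
    · simp [h]
    · have hmn : m < n := by omega
      simp [hm, hmn]
  · split_ifs with h
    · rfl
    · have : (i : ℕ) + 1 = n := by
        rw [Finset.mem_range] at h; omega
      rw [show (i : ℕ) + 2 = n + 1 by omega, zeroExtend_add_one]

theorem gramA_isSymm (n : ℕ) : (gramA n).IsSymm := by
  ext i j
  simp only [Matrix.transpose_apply, gramA, Matrix.of_apply, Fin.ext_iff]
  split_ifs <;> omega

theorem gForm_gramA_single {n : ℕ} (β : Fin n → ℤ) (i : Fin n) :
    gForm (gramA n) β (Pi.single i 1) = (gramA n *ᵥ β) i := by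
  rw [gForm, Matrix.dotProduct_mulVec, ← Matrix.mulVec_transpose, gramA_isSymm,
    dotProduct_single_one]

theorem gForm_gramA_self {n : ℕ} (β : Fin n → ℤ) :
    gForm (gramA n) β β =
      ∑ k ∈ Finset.range (n + 1), (zeroExtend β (k + 1) - zeroExtend β k) ^ 2 := by
  have h := sum_range_mul_second_difference (zeroExtend β) n
  rw [← Fin.sum_univ_eq_sum_range
    (fun i => zeroExtend β (i + 1) * (2 * zeroExtend β (i + 1) - zeroExtend β i
      - zeroExtend β (i + 2)))] at h
  simpa [gForm, dotProduct, gramA_mulVec] using h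

theorem gForm_two_smul_self {n : ℕ} (G : Matrix (Fin n) (Fin n) ℤ) (γ : Fin n → ℤ) :
    gForm G ((2 : ℤ) • γ) ((2 : ℤ) • γ) = 4 * gForm G γ γ := by
  simp only [gForm, Matrix.mulVec_smul, smul_dotProduct, dotProduct_smul, smul_eq_mul]
  ring

theorem exists_zeroExtend_sub_ne_zero {n : ℕ} {β : Fin n → ℤ} (hβ : β ≠ 0) :
    ∃ k ∈ Finset.range (n + 1), zeroExtend β (k + 1) - zeroExtend β k ≠ 0 := by
  by_contra! h
  have hzero : ∀ k ≤ n + 1, zeroExtend β k = 0 := by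
    intro k
    induction k with
    | zero => simp
    | succ k ih =>
      intro hk
      have := h k (Finset.mem_range.2 hk)
      have := ih (by omega)
      omega
  exact hβ (funext fun i => by simpa using hzero (i + 1) (by omega))

/-- For `n > 3`, the screeners of the root lattice `A_n` are exactly
its roots, i.e. the elements of norm squared `2`. -/
theorem screeners_of_An_are_roots
    (n : ℕ) (hn : 3 < n) (β : Fin n → ℤ) :
    IsScreenerM (gramA n) β ↔ gForm (gramA n) β β = 2 := by
  constructor
  · rintro ⟨heven, hprim, hdvd⟩
    obtain ⟨M, hM⟩ := heven.two_dvd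
    have hβ : β ≠ 0 := fun h => hprim ⟨0, by simp [h]⟩
    set x : ℕ → ℤ := fun k => zeroExtend β (k + 1) - zeroExtend β k with hx
    have hstep (i : ℕ) (hi : i < n) : M ∣ x i - x (i + 1) := by
      have h := hdvd (Pi.single ⟨i, hi⟩ 1)
      rw [hM, gForm_gramA_single, gramA_mulVec] at h
      rw [show x i - x (i + 1) = 2 * zeroExtend β (i + 1) - zeroExtend β i - zeroExtend β (i + 2) by
        simp only [hx]; ring]
      exact (mul_dvd_mul_iff_left two_ne_zero).1 h
    have hzero : ∀ k ≤ n, M ∣ x 0 - x k := by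
      intro k
      induction k with
      | zero => simp
      | succ k ih =>
        intro hk
        simpa using dvd_add (ih (by omega)) (hstep k hk)
    have hone : M = 1 := by
      refine eq_one_of_sum_sq_eq_two_mul (s := Finset.range (n + 1)) (x := x) ?_ ?_
        (exists_zeroExtend_sub_ne_zero hβ) ?_ ?_
      · rw [Finset.card_range]; omega
      · rw [hx, Finset.sum_range_sub]; simp
      · rw [← hM, gForm_gramA_self]
      · intro i hi j hj
        rw [Finset.mem_range] at hi hj
        simpa using dvd_sub (hzero j (by omega)) (hzero i (by omega))
    rw [hM, hone, mul_one]
  · intro h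
    refine ⟨h ▸ even_two, ?_, fun γ => h ▸ dvd_mul_right _ _⟩
    rintro ⟨γ, rfl⟩
    rw [gForm_two_smul_self] at h
    omega
end

section
/- Let L be the lattice ℤ³ with bilinear form given by the A₃ Gram matrix with rows (2, −1, 0), (−1, 2, −1), (0, −1, 2) with respect to the standard basis e₁, e₂, e₃. Then the set of screeners of L is exactly the union of the set of roots {β ∈ L : ⟨β, β⟩ = 2} with the six elements {±(e₁ + e₃), ±(e₁ − e₃), ±(e₁ + 2e₂ + e₃)}, each of which has norm squared 4; together these screeners form a copy of the C₃ root system. -/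
open Matrix

/-- The Gram matrix of the root lattice `A₃`. -/
def gramA3 : Matrix (Fin 3) (Fin 3) ℤ := !![2, -1, 0; -1, 2, -1; 0, -1, 2]

theorem gForm_gramA3 (β γ : Fin 3 → ℤ) :
    gForm gramA3 β γ = β 0 * (2 * γ 0 - γ 1) + β 1 * (-γ 0 + 2 * γ 1 - γ 2)
      + β 2 * (-γ 1 + 2 * γ 2) := by
  simp [gForm, gramA3, dotProduct, mulVec, Fin.sum_univ_three]
  ring

/-- A positive integer `N` dividing `2a`, where `a ≠ 0` and `a² ≤ 2N`, is at most `8`. -/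
theorem le_eight_of_dvd_two_mul {N a : ℤ} (hdvd : N ∣ 2 * a) (ha : a ≠ 0)
    (hsq : a ^ 2 ≤ 2 * N) : N ≤ 8 := by
  have hle : N ≤ 2 * |a| := by
    have h := Int.le_of_dvd (abs_pos.2 (mul_ne_zero two_ne_zero ha)) ((dvd_abs _ _).2 hdvd)
    simpa [abs_mul] using h
  nlinarith [sq_abs a, abs_pos.2 ha]

/-- The screener conditions of `A₃` that only involve pairing with the standard basis force
small coordinates. -/
theorem coord_mem_Icc_of_dvd {x y z N : ℤ}
    (hN : N = x * (2 * x - y) + y * (-x + 2 * y - z) + z * (-y + 2 * z))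
    (h₁ : N ∣ 2 * (2 * x - y)) (h₂ : N ∣ 2 * (-x + 2 * y - z)) (h₃ : N ∣ 2 * (-y + 2 * z)) :
    x ∈ Finset.Icc (-2 : ℤ) 2 ∧ y ∈ Finset.Icc (-2 : ℤ) 2 ∧ z ∈ Finset.Icc (-2 : ℤ) 2 := by
  have hN8 : N ≤ 8 := by
    by_cases ha : 2 * x - y = 0
    · by_cases hb : -x + 2 * y - z = 0
      · by_cases hc : -y + 2 * z = 0
        · simp [hN, ha, hb, hc]
        · exact le_eight_of_dvd_two_mul h₃ hc
            (by nlinarith [sq_nonneg x, sq_nonneg (x - y), sq_nonneg y])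
      · exact le_eight_of_dvd_two_mul h₂ hb
          (by nlinarith [sq_nonneg x, sq_nonneg z, sq_nonneg (x - z)])
    · exact le_eight_of_dvd_two_mul h₁ ha
        (by nlinarith [sq_nonneg z, sq_nonneg (z - y), sq_nonneg y])
  have hx : 4 * x ^ 2 ≤ 3 * N := by
    nlinarith [sq_nonneg (3 * y - 2 * x - 2 * z), sq_nonneg (x - 3 * z), sq_nonneg (2 * y - x - z),
      sq_nonneg (2 * z - y), sq_nonneg (3 * y - 2 * x)]
  have hy : y ^ 2 ≤ N := by nlinarith [sq_nonneg (2 * x - y), sq_nonneg (2 * z - y)]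
  have hz : 4 * z ^ 2 ≤ 3 * N := by
    nlinarith [sq_nonneg (2 * x - y), sq_nonneg (3 * y - 2 * z)]
  simp only [Finset.mem_Icc]
  refine ⟨⟨?_, ?_⟩, ⟨?_, ?_⟩, ⟨?_, ?_⟩⟩ <;> nlinarith

/-- The classification of small screeners of `A₃`, by enumeration. -/
theorem small_screener_A3 : ∀ x ∈ Finset.Icc (-2 : ℤ) 2, ∀ y ∈ Finset.Icc (-2 : ℤ) 2,
    ∀ z ∈ Finset.Icc (-2 : ℤ) 2,
    ¬ (2 ∣ x ∧ 2 ∣ y ∧ 2 ∣ z) →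
    x * (2 * x - y) + y * (-x + 2 * y - z) + z * (-y + 2 * z) ∣ 2 * (2 * x - y) →
    x * (2 * x - y) + y * (-x + 2 * y - z) + z * (-y + 2 * z) ∣ 2 * (-x + 2 * y - z) →
    x * (2 * x - y) + y * (-x + 2 * y - z) + z * (-y + 2 * z) ∣ 2 * (-y + 2 * z) →
    x * (2 * x - y) + y * (-x + 2 * y - z) + z * (-y + 2 * z) = 2 ∨
      (![x, y, z] = ![1, 0, 1] ∨ ![x, y, z] = ![-1, 0, -1] ∨ ![x, y, z] = ![1, 0, -1] ∨
        ![x, y, z] = ![-1, 0, 1] ∨ ![x, y, z] = ![1, 2, 1] ∨ ![x, y, z] = ![-1, -2, -1]) := by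
  decide +kernel

theorem even_gForm_gramA3 (β : Fin 3 → ℤ) : Even (gForm gramA3 β β) := by
  rw [gForm_gramA3]
  exact ⟨β 0 ^ 2 + β 1 ^ 2 + β 2 ^ 2 - β 0 * β 1 - β 1 * β 2, by ring⟩

/-- Roots of `A₃` are screeners. -/
theorem isScreenerM_gramA3_of_root {β : Fin 3 → ℤ} (h : gForm gramA3 β β = 2) :
    IsScreenerM gramA3 β := by
  refine ⟨even_gForm_gramA3 β, ?_, fun γ => h ▸ dvd_mul_right _ _⟩
  rintro ⟨γ, rfl⟩
  rw [gForm_gramA3] at h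
  simp only [Pi.smul_apply, smul_eq_mul] at h
  ring_nf at h
  omega

/-- The screeners of the root lattice `A₃` are exactly its roots
(norm squared 2) together with the six nonroot screeners
`±(e₁+e₃), ±(e₁−e₃), ±(e₁+2e₂+e₃)`, each of norm squared 4 (forming `C₃`). -/
theorem screeners_of_A3
    : (∀ β : Fin 3 → ℤ, IsScreenerM gramA3 β ↔
        (gForm gramA3 β β = 2 ∨
          β ∈ ({![1, 0, 1], ![-1, 0, -1], ![1, 0, -1], ![-1, 0, 1],
                ![1, 2, 1], ![-1, -2, -1]} : Set (Fin 3 → ℤ)))) ∧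
      (∀ β ∈ ({![1, 0, 1], ![-1, 0, -1], ![1, 0, -1], ![-1, 0, 1],
                ![1, 2, 1], ![-1, -2, -1]} : Set (Fin 3 → ℤ)),
          gForm gramA3 β β = 4) := by
  have norm_four : ∀ β ∈ ({![1, 0, 1], ![-1, 0, -1], ![1, 0, -1], ![-1, 0, 1],
      ![1, 2, 1], ![-1, -2, -1]} : Set (Fin 3 → ℤ)), gForm gramA3 β β = 4 := by
    rintro β (rfl | rfl | rfl | rfl | rfl | rfl) <;> simp [gForm_gramA3]
  refine ⟨fun β => ⟨?_, ?_⟩, norm_four⟩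
  · rintro ⟨-, hprim, hdvd⟩
    have h₁ := hdvd ![1, 0, 0]
    have h₂ := hdvd ![0, 1, 0]
    have h₃ := hdvd ![0, 0, 1]
    obtain ⟨x, y, z, rfl⟩ : ∃ x y z, β = ![x, y, z] :=
      ⟨β 0, β 1, β 2, by ext i; fin_cases i <;> rfl⟩
    have hodd : ¬ (2 ∣ x ∧ 2 ∣ y ∧ 2 ∣ z) := by
      rintro ⟨⟨a, rfl⟩, ⟨b, rfl⟩, ⟨c, rfl⟩⟩
      exact hprim ⟨![a, b, c], by simp⟩
    simp only [gForm_gramA3, cons_val] at h₁ h₂ h₃ ⊢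
    rw [show x * (2 * 1 - 0) + y * (-1 + 2 * 0 - 0) + z * (-0 + 2 * 0) =
      2 * x - y by ring] at h₁
    rw [show x * (2 * 0 - 1) + y * (-0 + 2 * 1 - 0) + z * (-1 + 2 * 0) =
      -x + 2 * y - z by ring] at h₂
    rw [show x * (2 * 0 - 0) + y * (-0 + 2 * 0 - 1) + z * (-0 + 2 * 1) =
      -y + 2 * z by ring] at h₃
    obtain ⟨hx, hy, hz⟩ := coord_mem_Icc_of_dvd rfl h₁ h₂ h₃
    exact small_screener_A3 x hx y hy z hz hodd h₁ h₂ h₃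
  · rintro (h | h)
    · exact isScreenerM_gramA3_of_root h
    · refine ⟨even_gForm_gramA3 β, ?_, fun γ => ?_⟩
      · rintro ⟨γ, rfl⟩
        have h₀ : (2 : ℤ) * γ 0 = 1 ∨ (2 : ℤ) * γ 0 = -1 := by
          rcases h with h | h | h | h | h | h <;> have := congrFun h 0 <;> simp_all
        omega
      · rw [norm_four β h, gForm_gramA3]
        rcases h with rfl | rfl | rfl | rfl | rfl | rfl <;> simp <;> omega
end

section
/- Let L be the lattice ℤ⁴ with bilinear form given by the D₄ Gram matrix G, where G_{ii} = 2 for all i, G_{13} = G_{31} = G_{23} = G_{32} = G_{34} = G_{43} = −1, and all other off-diagonal entries are 0 (so e₃ is the central node joined to e₁, e₂, e₄). Then the set of screeners of L is exactly the union of the set of roots {β ∈ L : ⟨β, β⟩ = 2} with the following 24 elements of norm squared 4: ±(e_i + e_j) and ±(e_i − e_j) for distinct i, j ∈ {1, 2, 4}, ±(e_i + 2e₃ + e_j) for distinct i, j ∈ {1, 2, 4}, and ±(2e_i + e_j + 2e₃ + e_k) for {i, j, k} = {1, 2, 4}; together these screeners form a copy of the F₄ root system. -/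
open Matrix

/-- The Gram matrix of the root lattice `D₄`, with `e₃` (index 2) the central node
joined to `e₁, e₂, e₄` (indices 0, 1, 3). -/
def gramD4 : Matrix (Fin 4) (Fin 4) ℤ :=
  !![2, 0, -1, 0; 0, 2, -1, 0; -1, -1, 2, -1; 0, 0, -1, 2]

/-- The 24 nonroot screeners of `D₄`: `±(e_i + e_j)`, `±(e_i − e_j)`,
`±(e_i + 2e₃ + e_j)` for distinct `i, j ∈ {1,2,4}`, and
`±(2e_i + e_j + 2e₃ + e_k)` for `{i,j,k} = {1,2,4}` (in coordinates `(e₁,e₂,e₃,e₄)`). -/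
def d4Extra : Set (Fin 4 → ℤ) :=
  {![1, 1, 0, 0], ![-1, -1, 0, 0], ![1, 0, 0, 1], ![-1, 0, 0, -1],
   ![0, 1, 0, 1], ![0, -1, 0, -1],
   ![1, -1, 0, 0], ![-1, 1, 0, 0], ![1, 0, 0, -1], ![-1, 0, 0, 1],
   ![0, 1, 0, -1], ![0, -1, 0, 1],
   ![1, 1, 2, 0], ![-1, -1, -2, 0], ![1, 0, 2, 1], ![-1, 0, -2, -1],
   ![0, 1, 2, 1], ![0, -1, -2, -1],
   ![2, 1, 2, 1], ![-2, -1, -2, -1], ![1, 2, 2, 1], ![-1, -2, -2, -1],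
   ![1, 1, 2, 2], ![-1, -1, -2, -2]}

/-- The `D₄` form written out in coordinates. -/
theorem gForm_gramD4 (x y : Fin 4 → ℤ) :
    gForm gramD4 x y =
      (2 * x 0 - x 2) * y 0 + (2 * x 1 - x 2) * y 1 +
        (2 * x 2 - x 0 - x 1 - x 3) * y 2 + (2 * x 3 - x 2) * y 3 := by
  simp [gForm, gramD4, Matrix.mulVec, dotProduct, Fin.sum_univ_four]
  ring

/-- If half the norm of a nonzero vector of `D₄` divides its inner products with the basis
vectors, then it is `1` or `2`. -/
theorem eq_one_or_two_of_dvd_gramD4 {a b c d m : ℤ} (hm : 0 < m)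
    (h : m = a ^ 2 + b ^ 2 + c ^ 2 + d ^ 2 - (a + b + d) * c)
    (ha : m ∣ 2 * a - c) (hb : m ∣ 2 * b - c) (hd : m ∣ 2 * d - c)
    (hc : m ∣ 2 * c - a - b - d) : m = 1 ∨ m = 2 := by
  obtain ⟨X, hX⟩ := ha
  obtain ⟨Y, hY⟩ := hb
  obtain ⟨Z, hZ⟩ := hd
  obtain ⟨T, hT⟩ := hc
  have hC : c = m * (2 * T + X + Y + Z) := by linear_combination 2 * hT + hX + hY + hZ
  have h4 : 4 = m * (X ^ 2 + Y ^ 2 + Z ^ 2 + (2 * T + X + Y + Z) ^ 2) := by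
    apply mul_left_cancel₀ hm.ne'
    linear_combination 4 * h + (2 * a - c + m * X) * hX + (2 * b - c + m * Y) * hY +
      (2 * d - c + m * Z) * hZ + (c + m * (2 * T + X + Y + Z)) * hC
  have hle : m ≤ 4 := Int.le_of_dvd (by norm_num) ⟨_, h4⟩
  have even_sum : X ^ 2 + Y ^ 2 + Z ^ 2 + (2 * T + X + Y + Z) ^ 2 =
      2 * (X ^ 2 + Y ^ 2 + Z ^ 2 + 2 * T ^ 2 + 2 * T * (X + Y + Z) + X * Y + X * Z + Y * Z) := by
    ring
  rw [even_sum] at h4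
  interval_cases m <;> omega

/-- The vectors of norm squared 4 in `D₄`. -/
theorem mem_d4Extra_of_gForm_eq_four {β : Fin 4 → ℤ} (h : gForm gramD4 β β = 4) :
    β ∈ d4Extra := by
  obtain ⟨a, b, c, d, rfl⟩ : ∃ a b c d : ℤ, β = ![a, b, c, d] :=
    ⟨β 0, β 1, β 2, β 3, by ext i; fin_cases i <;> rfl⟩
  simp only [gForm_gramD4, Matrix.cons_val] at h
  have hsq : (2 * a - c) ^ 2 + (2 * b - c) ^ 2 + (2 * d - c) ^ 2 + c ^ 2 = 8 := by
    linear_combination 2 * h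
  have hc : Even c := by
    by_contra hodd
    rw [Int.not_even_iff_odd] at hodd
    have sq_mod {t : ℤ} (ht : Odd t) : t ^ 2 % 8 = 1 := by
      have := Int.eight_dvd_sq_sub_one_of_odd ht
      omega
    have hx (t : ℤ) : (2 * t - c) ^ 2 % 8 = 1 := sq_mod ((even_two_mul t).sub_odd hodd)
    have := hx a
    have := hx b
    have := hx d
    have := sq_mod hodd
    omega
  obtain ⟨C, rfl⟩ := even_iff_exists_two_mul.1 hc
  obtain ⟨X, rfl⟩ : ∃ X, a = C + X := ⟨a - C, by ring⟩
  obtain ⟨Y, rfl⟩ : ∃ Y, b = C + Y := ⟨b - C, by ring⟩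
  obtain ⟨Z, rfl⟩ : ∃ Z, d = C + Z := ⟨d - C, by ring⟩
  replace hsq : X ^ 2 + Y ^ 2 + Z ^ 2 + C ^ 2 = 2 := by linarith
  have abs_le_one {t : ℤ} (ht : t ^ 2 ≤ 2) : -1 ≤ t ∧ t ≤ 1 := by
    constructor <;> nlinarith
  have hfin : ∀ X ∈ Finset.Icc (-1 : ℤ) 1, ∀ Y ∈ Finset.Icc (-1 : ℤ) 1,
      ∀ Z ∈ Finset.Icc (-1 : ℤ) 1, ∀ C ∈ Finset.Icc (-1 : ℤ) 1,
      X ^ 2 + Y ^ 2 + Z ^ 2 + C ^ 2 = 2 → ![C + X, C + Y, 2 * C, C + Z] ∈ d4Extra := by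
    simp only [d4Extra, Set.mem_insert_iff, Set.mem_singleton_iff]
    decide +kernel
  exact hfin X (Finset.mem_Icc.2 (abs_le_one (by nlinarith)))
    Y (Finset.mem_Icc.2 (abs_le_one (by nlinarith)))
    Z (Finset.mem_Icc.2 (abs_le_one (by nlinarith)))
    C (Finset.mem_Icc.2 (abs_le_one (by nlinarith))) hsq

theorem gForm_gramD4_self_of_mem_d4Extra {β : Fin 4 → ℤ} (h : β ∈ d4Extra) :
    gForm gramD4 β β = 4 := by
  simp only [d4Extra, Set.mem_insert_iff, Set.mem_singleton_iff] at h
  rcases h with h | h | h | h | h | h | h | h | h | h | h | h | h | h | h | h | h | h | h | h |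
    h | h | h | h <;> subst h <;> decide

theorem four_dvd_two_mul_gForm_of_mem_d4Extra {β : Fin 4 → ℤ} (h : β ∈ d4Extra)
    (γ : Fin 4 → ℤ) : 4 ∣ 2 * gForm gramD4 β γ := by
  rw [gForm_gramD4]
  simp only [d4Extra, Set.mem_insert_iff, Set.mem_singleton_iff] at h
  rcases h with h | h | h | h | h | h | h | h | h | h | h | h | h | h | h | h | h | h | h | h |
    h | h | h | h <;> subst h <;> simp only [Matrix.cons_val] <;> omega

/-- The screeners of `D₄` are exactly its roots (norm squared 2) together
with the 24 nonroot screeners of norm squared 4 listed in `d4Extra` (forming `F₄`). -/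
theorem screeners_of_D4
    : (∀ β : Fin 4 → ℤ, IsScreenerM gramD4 β ↔
        (gForm gramD4 β β = 2 ∨ β ∈ d4Extra)) ∧
      (∀ β ∈ d4Extra, gForm gramD4 β β = 4) := by
  refine ⟨fun β => ⟨fun ⟨_, hprim, hdvd⟩ => ?_, fun h => ?_⟩,
    fun β => gForm_gramD4_self_of_mem_d4Extra⟩
  · obtain ⟨m, hm⟩ : ∃ m, m = β 0 ^ 2 + β 1 ^ 2 + β 2 ^ 2 + β 3 ^ 2 -
        (β 0 + β 1 + β 3) * β 2 := ⟨_, rfl⟩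
    have hnorm : gForm gramD4 β β = 2 * m := by rw [gForm_gramD4, hm]; ring
    have hsq : 4 * m = (2 * β 0 - β 2) ^ 2 + (2 * β 1 - β 2) ^ 2 + (2 * β 3 - β 2) ^ 2 +
        β 2 ^ 2 := by rw [hm]; ring
    have hpos : 0 < m := by
      by_contra! hle
      have h2 : β 2 = 0 := by rw [← sq_eq_zero_iff]; nlinarith
      have h0 : 2 * β 0 - β 2 = 0 := by rw [← sq_eq_zero_iff]; nlinarith
      have h1 : 2 * β 1 - β 2 = 0 := by rw [← sq_eq_zero_iff]; nlinarith
      have h3 : 2 * β 3 - β 2 = 0 := by rw [← sq_eq_zero_iff]; nlinarith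
      refine hprim ⟨0, ?_⟩
      ext i
      fin_cases i <;> simp <;> omega
    have hdvd' (γ : Fin 4 → ℤ) : m ∣ gForm gramD4 β γ :=
      (mul_dvd_mul_iff_left two_ne_zero).1 (hnorm ▸ hdvd γ)
    rcases eq_one_or_two_of_dvd_gramD4 hpos hm
      (by simpa [gForm_gramD4] using hdvd' ![1, 0, 0, 0])
      (by simpa [gForm_gramD4] using hdvd' ![0, 1, 0, 0])
      (by simpa [gForm_gramD4] using hdvd' ![0, 0, 0, 1])
      (by simpa [gForm_gramD4] using hdvd' ![0, 0, 1, 0]) with rfl | rfl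
    · exact Or.inl hnorm
    · exact Or.inr (mem_d4Extra_of_gForm_eq_four hnorm)
  · have hcases : gForm gramD4 β β = 2 ∨ gForm gramD4 β β = 4 :=
      h.imp_right gForm_gramD4_self_of_mem_d4Extra
    refine ⟨by rcases hcases with h | h <;> rw [h] <;> decide, ?_, fun γ => ?_⟩
    · rintro ⟨γ, rfl⟩
      have h8 : gForm gramD4 ((2 : ℤ) • γ) ((2 : ℤ) • γ) = 8 * (γ 0 ^ 2 + γ 1 ^ 2 + γ 2 ^ 2 +
          γ 3 ^ 2 - (γ 0 + γ 1 + γ 3) * γ 2) := by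
        rw [gForm_gramD4]
        simp only [Pi.smul_apply, smul_eq_mul]
        ring
      omega
    · rcases h with h | h
      · exact h ▸ dvd_mul_right _ _
      · exact gForm_gramD4_self_of_mem_d4Extra h ▸ four_dvd_two_mul_gForm_of_mem_d4Extra h γ
end
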